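/- Let m be a positive integer, B ∈ ℝ^{m×m} an invertible matrix with rows b_1, …, b_m ∈ ℝ^m, and set G = BᵀB. Let k_d ∈ ℝ^m, and for each i ∈ {1,…,m} let a_i ∈ ℝ, α_i > 0, y_i ∈ ℝ, and y̲_i < ȳ_i. Define ω̲_i = a_i + α_i(y_i − y̲_i) + ⟨b_i, k_d⟩, ω̄_i = −a_i − α_i(y_i − ȳ_i) − ⟨b_i, k_d⟩, λ̲_i = max(0, −ω̲_i), λ̄_i = max(0, −ω̄_i), and u* = k_d + Σ_{i=1}^m (λ̲_i − λ̄_i) G^{-1} b_i. Let K = {u ∈ ℝ^m : for all i, a_i + ⟨b_i, u⟩ + α_i(y_i − y̲_i) ≥ 0 and −a_i − ⟨b_i, u⟩ − α_i(y_i − ȳ_i) ≥ 0}. Then u* ∈ K, and for every u ∈ K one has ⟨u* − k_d, G(u* − k_d)⟩ ≤ ⟨u − k_d, G(u − k_d)⟩, with equality only if u = u*; i.e., u* is the unique minimizer of the weighted quadratic cost over K. (Theorem 3: closed-form solution of the multi-ECBF quadratic program.) -/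

import Mathlib

open Matrix

/-- For invertible `B`, the dual basis of the rows of `B` with respect to the Gram matrix
`Bᵀ * B` is read off by `B` itself. -/
theorem mulVec_sum_smul_gram_inv_row {n R : Type*} [Fintype n] [DecidableEq n] [CommRing R]
    {B : Matrix n n R} (hB : IsUnit B.det) (c : n → R) :
    B *ᵥ ∑ i, c i • (Bᵀ * B)⁻¹ *ᵥ B i = c := by
  have hsum : ∑ i, c i • (Bᵀ * B)⁻¹ *ᵥ B i = (Bᵀ * B)⁻¹ *ᵥ (Bᵀ *ᵥ c) := by
    simp_rw [← mulVec_smul, ← mulVec_sum]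
    rw [mulVec_transpose, vecMul_eq_sum]
  have hBt : IsUnit Bᵀ.det := by rwa [det_transpose]
  rw [hsum, mulVec_mulVec, mulVec_mulVec, Matrix.mul_inv_rev, Matrix.mul_assoc, Matrix.mul_assoc,
    nonsing_inv_mul _ hBt, Matrix.mul_one, mul_nonsing_inv _ hB, one_mulVec]

theorem dotProduct_gram_mulVec {n R : Type*} [Fintype n] [CommRing R]
    (B : Matrix n n R) (v : n → R) :
    v ⬝ᵥ (Bᵀ * B) *ᵥ v = ∑ i, (B *ᵥ v) i ^ 2 := by
  rw [← mulVec_mulVec, dotProduct_mulVec, vecMul_transpose]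
  simp only [dotProduct, sq]

/-- The point of the interval `[-p, q]` nearest to zero is `max 0 (-p) - max 0 (-q)`. -/
theorem neg_le_max_sub_max_le {p q : ℝ} (h : 0 ≤ p + q) :
    -p ≤ max 0 (-p) - max 0 (-q) ∧ max 0 (-p) - max 0 (-q) ≤ q := by
  rcases max_cases 0 (-p) with ⟨h₁, _⟩ | ⟨h₁, _⟩ <;>
    rcases max_cases 0 (-q) with ⟨h₂, _⟩ | ⟨h₂, _⟩ <;>
    rw [h₁, h₂] <;> constructor <;> linarith

/-- Pythagorean inequality for the projection of zero onto the interval `[-p, q]`. -/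
theorem sq_max_sub_max_add_sq_le {p q v : ℝ} (hp : -p ≤ v) (hq : v ≤ q) :
    (max 0 (-p) - max 0 (-q)) ^ 2 + (v - (max 0 (-p) - max 0 (-q))) ^ 2 ≤ v ^ 2 := by
  rcases max_cases 0 (-p) with ⟨h₁, _⟩ | ⟨h₁, _⟩ <;>
    rcases max_cases 0 (-q) with ⟨h₂, _⟩ | ⟨h₂, _⟩ <;>
    rw [h₁, h₂] <;> nlinarith

/-- Theorem 3: closed-form solution of the multi-ECBF quadratic program.
With `B` invertible with rows `b i = B i`, weight `G = Bᵀ * B`, and the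
explicit multipliers `λ̲ i = max 0 (−ω̲ i)`, `λ̄ i = max 0 (−ω̄ i)`, the point
`u* = k_d + ∑ i (λ̲ i − λ̄ i) • G⁻¹ *ᵥ b i` is the unique minimizer of the
weighted quadratic cost over the feasible set `K` of the ECBF constraints. -/
theorem ecbf_qp_closed_form (m : ℕ) (hm : 0 < m)
    (B : Matrix (Fin m) (Fin m) ℝ) (hB : IsUnit B.det)
    (G : Matrix (Fin m) (Fin m) ℝ) (hG : G = Bᵀ * B)
    (kd : Fin m → ℝ) (a α y ylo yhi : Fin m → ℝ)
    (hα : ∀ i, 0 < α i) (hy : ∀ i, ylo i < yhi i)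
    (wlo whi lamlo lamhi : Fin m → ℝ)
    (hwlo : ∀ i, wlo i = a i + α i * (y i - ylo i) + B i ⬝ᵥ kd)
    (hwhi : ∀ i, whi i = -a i - α i * (y i - yhi i) - B i ⬝ᵥ kd)
    (hlamlo : ∀ i, lamlo i = max 0 (-wlo i))
    (hlamhi : ∀ i, lamhi i = max 0 (-whi i))
    (ustar : Fin m → ℝ)
    (hustar : ustar = kd + ∑ i, (lamlo i - lamhi i) • G⁻¹.mulVec (B i))
    (K : Set (Fin m → ℝ))
    (hK : K = {u : Fin m → ℝ | ∀ i : Fin m,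
      0 ≤ a i + B i ⬝ᵥ u + α i * (y i - ylo i) ∧
      0 ≤ -a i - B i ⬝ᵥ u - α i * (y i - yhi i)}) :
    ustar ∈ K ∧ ∀ u ∈ K,
      (ustar - kd) ⬝ᵥ G.mulVec (ustar - kd) ≤ (u - kd) ⬝ᵥ G.mulVec (u - kd) ∧
      ((u - kd) ⬝ᵥ G.mulVec (u - kd) = (ustar - kd) ⬝ᵥ G.mulVec (ustar - kd) →
        u = ustar) := by
  subst hG hK
  obtain rfl : lamlo = fun i ↦ max 0 (-wlo i) := funext hlamlo
  obtain rfl : lamhi = fun i ↦ max 0 (-whi i) := funext hlamhi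
  have hstar : B *ᵥ (ustar - kd) = fun i ↦ max 0 (-wlo i) - max 0 (-whi i) := by
    rw [hustar, add_sub_cancel_left]
    exact mulVec_sum_smul_gram_inv_row hB _
  have hrow (u : Fin m → ℝ) (i : Fin m) : (B *ᵥ (u - kd)) i = B i ⬝ᵥ u - B i ⬝ᵥ kd :=
    dotProduct_sub _ _ _
  refine ⟨fun i ↦ ?_, fun u hu ↦ ?_⟩
  · have hwidth : 0 ≤ wlo i + whi i := by
      rw [hwlo, hwhi]
      nlinarith [mul_pos (hα i) (sub_pos.2 (hy i))]
    obtain ⟨hlo, hhi⟩ := neg_le_max_sub_max_le hwidth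
    have hi := (hrow ustar i).symm.trans (congrFun hstar i)
    rw [← hi] at hlo hhi
    constructor <;> linarith [hwlo i, hwhi i]
  · have hpyth (i : Fin m) : (B *ᵥ (ustar - kd)) i ^ 2 +
        ((B *ᵥ (u - kd)) i - (B *ᵥ (ustar - kd)) i) ^ 2 ≤ (B *ᵥ (u - kd)) i ^ 2 := by
      rw [hstar]
      obtain ⟨hlo, hhi⟩ := hu i
      apply sq_max_sub_max_add_sq_le <;> linarith [hwlo i, hwhi i, hrow u i]
    have hle (i : Fin m) : (B *ᵥ (ustar - kd)) i ^ 2 ≤ (B *ᵥ (u - kd)) i ^ 2 :=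
      (le_add_of_nonneg_right (sq_nonneg _)).trans (hpyth i)
    rw [dotProduct_gram_mulVec, dotProduct_gram_mulVec]
    refine ⟨Finset.sum_le_sum fun i _ ↦ hle i, fun heq ↦ ?_⟩
    have hsq := (Finset.sum_eq_sum_iff_of_le fun i _ ↦ hle i).1 heq.symm
    have himage : B *ᵥ (u - kd) = B *ᵥ (ustar - kd) := by
      ext i
      refine sub_eq_zero.1 (pow_eq_zero_iff two_ne_zero |>.1 (le_antisymm ?_ (sq_nonneg _)))
      linarith [hpyth i, hsq i (Finset.mem_univ i)]
    exact sub_left_injective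
      (mulVec_injective_of_isUnit ((isUnit_iff_isUnit_det B).2 hB) himage)
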